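/- Let $X^{t,x}_{t+\tau} = x + \mu\tau + \sigma(W_{t+\tau} - W_t)$ and $\hat X^{t,x}_{t+\tau} = x + \mu\tau - \sigma(W_{t+\tau} - W_t)$ (antithetic path) with constant $\mu \in \mathbb{R}^d$ and invertible constant $\sigma \in \mathbb{R}^{d\times d}$, and let $\tau > 0$ be a fixed time. For any bounded measurable $h: \mathbb{R}^d \to \mathbb{R}$ that is continuously differentiable with bounded derivative, $\mathbb{E}\Big[\sigma^{-\top}\frac{W_{t+\tau} - W_t}{\tau}\cdot\frac12\big(h(X^{t,x}_{t+\tau}) - h(\hat X^{t,x}_{t+\tau})\big)\Big] = D_x\, \mathbb{E}\big[h(X^{t,x}_{t+\tau})\big]$, i.e. the antithetic Malliavin-weight estimator is an unbiased estimator of the gradient of the expectation. -/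

import Mathlib

open MeasureTheory ProbabilityTheory

open scoped NNReal

/-- The density of a centered Gaussian solves `p' = -(x / v) p`. -/
lemma hasDerivAt_gaussianPDFReal_zero (v : ℝ≥0) (x : ℝ) :
    HasDerivAt (gaussianPDFReal 0 v) (-(x / v) * gaussianPDFReal 0 v x) x := by
  rw [gaussianPDFReal_def]
  have h1 : HasDerivAt (fun x : ℝ => -(x - 0) ^ 2 / (2 * (v : ℝ))) (-(x / v)) x := by
    refine (((((hasDerivAt_id x).sub_const 0).pow 2).neg).div_const (2 * (v : ℝ))).congr_deriv ?_
    simp only [id, sub_zero]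
    push_cast
    rcases eq_or_ne (v : ℝ) 0 with hv | hv
    · simp [hv]
    · field_simp
  refine ((h1.exp).const_mul _).congr_deriv ?_
  ring

/-- Stein's identity for a centered real Gaussian. -/
lemma integral_id_mul_gaussianReal {v : ℝ≥0} (hv : v ≠ 0) {g g' : ℝ → ℝ}
    (hg : ∀ x, HasDerivAt g (g' x) x) {C C' : ℝ} (hC : ∀ x, |g x| ≤ C) (hC' : ∀ x, |g' x| ≤ C') :
    ∫ x, x * g x ∂(gaussianReal 0 v) = v * ∫ x, g' x ∂(gaussianReal 0 v) := by
  have hv' : (v : ℝ) ≠ 0 := by exact_mod_cast hv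
  have hgc : Continuous g := continuous_iff_continuousAt.2 fun x => (hg x).continuousAt
  have hg'm : Measurable g' := by
    rw [← funext fun x => (hg x).deriv]
    exact measurable_deriv g
  have hp := integrable_gaussianPDFReal 0 v
  have hxp : Integrable fun x : ℝ => -(x / v) * gaussianPDFReal 0 v x := by
    have h1 : Integrable (fun x : ℝ => x) (gaussianReal 0 v) :=
      (memLp_id_gaussianReal 1).integrable (by simp)
    rw [gaussianReal_of_var_ne_zero _ hv, integrable_withDensity_iff_integrable_smul'
      (measurable_gaussianPDF _ _) (ae_of_all _ fun _ => gaussianPDF_lt_top)] at h1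
    refine (h1.const_mul (-(v : ℝ)⁻¹)).congr (ae_of_all _ fun x => ?_)
    simp only [toReal_gaussianPDF, smul_eq_mul]
    ring
  have key := integral_mul_deriv_eq_deriv_mul_of_integrable
    (u := g) (v := gaussianPDFReal 0 v) (fun x _ => hg x)
    (fun x _ => hasDerivAt_gaussianPDFReal_zero v x)
    (hxp.bdd_mul hgc.aestronglyMeasurable (ae_of_all _ hC))
    (hp.bdd_mul hg'm.aestronglyMeasurable (ae_of_all _ hC'))
    (hp.bdd_mul hgc.aestronglyMeasurable (ae_of_all _ hC))
  rw [integral_gaussianReal_eq_integral_smul hv, integral_gaussianReal_eq_integral_smul hv]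
  have h2 : ∫ x, gaussianPDFReal 0 v x • (x * g x)
      = -(v : ℝ) * ∫ x, g x * (-(x / v) * gaussianPDFReal 0 v x) := by
    rw [← integral_const_mul]
    refine integral_congr_ae (ae_of_all _ fun x => ?_)
    simp only [smul_eq_mul]
    field_simp
  rw [h2, key]
  simp [mul_comm]

lemma hasDerivAt_insertNth {n : ℕ} (i : Fin (n + 1)) (y : Fin n → ℝ) (t : ℝ) :
    HasDerivAt (fun t : ℝ => (i.insertNth t y : Fin (n + 1) → ℝ)) (Pi.single i 1) t := by
  rw [hasDerivAt_pi, Fin.forall_iff_succAbove i]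
  refine ⟨?_, fun k => ?_⟩
  · simpa using hasDerivAt_id' t
  · simpa using hasDerivAt_const t (y k)

lemma integrable_eval_mul_pi_gaussianReal {d : ℕ} (v : ℝ≥0) (i : Fin d) {g : (Fin d → ℝ) → ℝ}
    (hg : Continuous g) {C : ℝ} (hC : ∀ w, |g w| ≤ C) :
    Integrable (fun w => w i * g w) (Measure.pi fun _ : Fin d => gaussianReal 0 v) := by
  have h1 : Integrable (fun w : Fin d → ℝ => w i) (Measure.pi fun _ : Fin d => gaussianReal 0 v) :=
    integrable_comp_eval (μ := fun _ : Fin d => gaussianReal 0 v) (f := fun x : ℝ => x)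
      ((memLp_id_gaussianReal 1).integrable (by simp))
  refine (h1.bdd_mul hg.aestronglyMeasurable (ae_of_all _ hC)).congr (ae_of_all _ fun w => ?_)
  exact mul_comm _ _

/-- Stein's identity for a product of centered real Gaussians, in a coordinate direction. -/
lemma integral_eval_mul_pi_gaussianReal {d : ℕ} {v : ℝ≥0} (hv : v ≠ 0) (i : Fin d)
    {g : (Fin d → ℝ) → ℝ} (hg : ContDiff ℝ 1 g) {C C' : ℝ} (hC : ∀ w, |g w| ≤ C)
    (hC' : ∀ w, ‖fderiv ℝ g w‖ ≤ C') :
    ∫ w, w i * g w ∂(Measure.pi fun _ : Fin d => gaussianReal 0 v)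
      = v * ∫ w, fderiv ℝ g w (Pi.single i 1)
          ∂(Measure.pi fun _ : Fin d => gaussianReal 0 v) := by
  cases d with
  | zero => exact i.elim0
  | succ n =>
  have hmp := (measurePreserving_piFinSuccAbove (fun _ : Fin (n + 1) => gaussianReal 0 v) i).symm
  have hC'' : ∀ w, |fderiv ℝ g w (Pi.single i 1)| ≤ C' * ‖(Pi.single i 1 : Fin (n + 1) → ℝ)‖ :=
    fun w => ((fderiv ℝ g w).le_opNorm _).trans (by gcongr; exact hC' w)
  have hg'c : Continuous fun w => fderiv ℝ g w (Pi.single i 1) :=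
    (hg.continuous_fderiv (by simp)).clm_apply continuous_const
  have hi1 := integrable_eval_mul_pi_gaussianReal v i hg.continuous hC
  have hi2 : Integrable (fun w => fderiv ℝ g w (Pi.single i 1))
      (Measure.pi fun _ : Fin (n + 1) => gaussianReal 0 v) :=
    Integrable.of_bound hg'c.aestronglyMeasurable _ (ae_of_all _ hC'')
  rw [← hmp.integrable_comp_emb (MeasurableEquiv.measurableEmbedding _), Function.comp_def] at hi1 hi2
  rw [← hmp.integral_comp', ← hmp.integral_comp', integral_prod_symm _ hi1,
    integral_prod_symm _ hi2, ← integral_const_mul]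
  refine integral_congr_ae (ae_of_all _ fun y => ?_)
  have h1 : ∀ t : ℝ, HasDerivAt (fun t : ℝ => g (i.insertNth t y))
      (fderiv ℝ g (i.insertNth t y) (Pi.single i 1)) t := fun t =>
    ((hg.differentiable (by simp)) _).hasFDerivAt.comp_hasDerivAt t (hasDerivAt_insertNth i y t)
  have h2 := integral_id_mul_gaussianReal hv h1 (fun t => hC _) (fun t => hC'' _)
  simpa [MeasurableEquiv.piFinSuccAbove, Fin.insertNthEquiv] using h2

/-- Stein's identity for a product of centered real Gaussians, in an arbitrary direction. -/
lemma integral_dotProduct_mul_pi_gaussianReal {d : ℕ} {v : ℝ≥0} (hv : v ≠ 0) (a : Fin d → ℝ)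
    {g : (Fin d → ℝ) → ℝ} (hg : ContDiff ℝ 1 g) {C C' : ℝ} (hC : ∀ w, |g w| ≤ C)
    (hC' : ∀ w, ‖fderiv ℝ g w‖ ≤ C') :
    ∫ w, (a ⬝ᵥ w) * g w ∂(Measure.pi fun _ : Fin d => gaussianReal 0 v)
      = v * ∫ w, fderiv ℝ g w a ∂(Measure.pi fun _ : Fin d => gaussianReal 0 v) := by
  have hi (i : Fin d) : Integrable (fun w => a i * fderiv ℝ g w (Pi.single i 1))
      (Measure.pi fun _ : Fin d => gaussianReal 0 v) :=
    (Integrable.of_bound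
      ((hg.continuous_fderiv (by simp)).clm_apply continuous_const).aestronglyMeasurable
      (C' * ‖(Pi.single i 1 : Fin d → ℝ)‖) (ae_of_all _ fun w =>
        ((fderiv ℝ g w).le_opNorm _).trans (by gcongr; exact hC' w))).const_mul _
  have ha (w : Fin d → ℝ) : fderiv ℝ g w a = ∑ i, a i * fderiv ℝ g w (Pi.single i 1) := by
    conv_lhs => rw [pi_eq_sum_univ' a]
    simp [map_sum]
  simp_rw [ha, dotProduct, Finset.sum_mul, mul_assoc]
  rw [integral_finsetSum _ fun i _ => hi i, integral_finsetSum _ fun i _ =>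
    (integrable_eval_mul_pi_gaussianReal v i hg.continuous hC).const_mul _, Finset.mul_sum]
  refine Finset.sum_congr rfl fun i _ => ?_
  rw [integral_const_mul, integral_const_mul, integral_eval_mul_pi_gaussianReal hv i hg hC hC']
  ring

instance isNegInvariant_gaussianReal_zero (v : ℝ≥0) : (gaussianReal 0 v).IsNegInvariant :=
  ⟨by simpa using! gaussianReal_map_neg (μ := 0) (v := v)⟩

/-- The Bismut-Elworthy-Li formula for the Gaussian shift `c + σ w`, `w ∼ 𝒩(0, v I_d)`. -/
lemma integral_malliavin_weight_mul {d : ℕ} {v : ℝ≥0} (hv : v ≠ 0)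
    {σ : Matrix (Fin d) (Fin d) ℝ} (hσ : IsUnit σ.det) {h : (Fin d → ℝ) → ℝ}
    (hC1 : ContDiff ℝ 1 h) {C C' : ℝ} (hC : ∀ y, |h y| ≤ C) (hC' : ∀ y, ‖fderiv ℝ h y‖ ≤ C')
    (c : Fin d → ℝ) (j : Fin d) :
    ∫ w, (σ⁻¹.transpose.mulVec w) j * h (c + σ.mulVec w)
        ∂(Measure.pi fun _ : Fin d => gaussianReal 0 v)
      = v * ∫ w, fderiv ℝ h (c + σ.mulVec w) (Pi.single j 1)
        ∂(Measure.pi fun _ : Fin d => gaussianReal 0 v) := by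
  let L : (Fin d → ℝ) →L[ℝ] (Fin d → ℝ) := LinearMap.toContinuousLinearMap σ.mulVecLin
  have hL : ∀ w, L w = σ.mulVec w := fun w => rfl
  have hD : ∀ w, fderiv ℝ (fun w => h (c + L w)) w = (fderiv ℝ h (c + L w)).comp L := fun w =>
    (((hC1.differentiable (by simp)) _).hasFDerivAt.comp w (L.hasFDerivAt.const_add c)).fderiv
  have hg : ContDiff ℝ 1 fun w => h (c + L w) := hC1.comp (contDiff_const.add L.contDiff)
  have key := integral_dotProduct_mul_pi_gaussianReal hv (σ⁻¹.transpose j) hg (fun w => hC _)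
    (C' := C' * ‖L‖) (fun w => by
      rw [hD]
      exact (ContinuousLinearMap.opNorm_comp_le _ _).trans (by gcongr; exact hC' _))
  have hσj : L (σ⁻¹.transpose j) = Pi.single j 1 := by
    have h1 : σ⁻¹.transpose j = σ⁻¹.mulVec (Pi.single j 1) := by
      rw [Matrix.mulVec_single_one]; rfl
    rw [hL, h1, Matrix.mulVec_mulVec, Matrix.mul_nonsing_inv _ hσ, Matrix.one_mulVec]
  simp only [hD, ContinuousLinearMap.comp_apply, hσj] at key
  exact key

lemma fderiv_integral_comp_add {d : ℕ} {α : Type*} [MeasurableSpace α] (P : Measure α)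
    [IsFiniteMeasure P] {h : (Fin d → ℝ) → ℝ} (hC1 : ContDiff ℝ 1 h) {C C' : ℝ}
    (hC : ∀ y, |h y| ≤ C) (hC' : ∀ y, ‖fderiv ℝ h y‖ ≤ C') {Y : α → Fin d → ℝ}
    (hY : Measurable Y) (x a : Fin d → ℝ) :
    fderiv ℝ (fun z => ∫ w, h (z + Y w) ∂P) x a = ∫ w, fderiv ℝ h (x + Y w) a ∂P := by
  have hm (z : Fin d → ℝ) : AEStronglyMeasurable (fun w => h (z + Y w)) P :=
    (hC1.continuous.measurable.comp (hY.const_add z)).aestronglyMeasurable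
  have hm' : AEStronglyMeasurable (fun w => fderiv ℝ h (x + Y w)) P :=
    ((hC1.continuous_fderiv (by simp)).measurable.comp (hY.const_add x)).aestronglyMeasurable
  have key := hasFDerivAt_integral_of_dominated_of_fderiv_le (μ := P) (x₀ := x)
    (F := fun z w => h (z + Y w)) (F' := fun z w => fderiv ℝ h (z + Y w))
    (bound := fun _ => C') Filter.univ_mem (Filter.Eventually.of_forall hm)
    (Integrable.of_bound (hm x) C (ae_of_all _ fun w => hC _)) hm'
    (ae_of_all _ fun w z _ => hC' _) (integrable_const _)
    (ae_of_all _ fun w z _ => by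
      simpa using! ((hC1.differentiable (by simp)) (z + Y w)).hasFDerivAt.comp z
        ((hasFDerivAt_id z).add_const (Y w)))
  rw [key.fderiv, ContinuousLinearMap.integral_apply
    (Integrable.of_bound hm' C' (ae_of_all _ fun w => hC' _))]

/-- Antithetic Malliavin-weight estimator is unbiased for the gradient: with
`X = x + τμ + σw`, `X̂ = x + τμ - σw` and `w ∼ 𝒩(0, τ I_d)`,
`E[σ⁻ᵀ (w/τ) · ½(h(X) - h(X̂))] = D_x E[h(X)]` for bounded `C¹` functions `h`
with bounded derivative. -/
theorem antithetic_malliavin_weight_unbiased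
    (d : ℕ) (τ : ℝ) (hτ : 0 < τ) (μv : Fin d → ℝ)
    (σ : Matrix (Fin d) (Fin d) ℝ) (hσ : IsUnit σ.det)
    (h : (Fin d → ℝ) → ℝ)
    (hC1 : ContDiff ℝ 1 h)
    (hbdd : ∃ C, ∀ y, |h y| ≤ C)
    (hDbdd : ∃ C, ∀ y, ‖fderiv ℝ h y‖ ≤ C) :
    ∀ (x : Fin d → ℝ) (j : Fin d),
      ∫ w, ((((σ⁻¹).transpose).mulVec w) j / τ) *
          ((1:ℝ)/2 * (h (x + τ • μv + σ.mulVec w) - h (x + τ • μv - σ.mulVec w)))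
        ∂(Measure.pi fun _ : Fin d => gaussianReal 0 τ.toNNReal)
      = fderiv ℝ
          (fun z : Fin d → ℝ =>
            ∫ w, h (z + τ • μv + σ.mulVec w)
              ∂(Measure.pi fun _ : Fin d => gaussianReal 0 τ.toNNReal))
          x (Pi.single j 1) := by
  obtain ⟨C, hC⟩ := hbdd
  obtain ⟨C', hC'⟩ := hDbdd
  intro x j
  have hv : τ.toNNReal ≠ 0 := by simpa using hτ
  set P := Measure.pi fun _ : Fin d => gaussianReal 0 τ.toNNReal with hP
  have hσm : Continuous fun w : Fin d → ℝ => σ.mulVec w := by fun_prop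
  set f : (Fin d → ℝ) → ℝ := fun w =>
    (σ⁻¹.transpose.mulVec w) j * h (x + τ • μv + σ.mulVec w) with hf
  have hfi : Integrable f P := by
    have hcont : Continuous fun w => h (x + τ • μv + σ.mulVec w) :=
      hC1.continuous.comp (continuous_const.add hσm)
    refine (integrable_finsetSum Finset.univ fun i _ =>
      (integrable_eval_mul_pi_gaussianReal τ.toNNReal i hcont fun w => hC _).const_mul
        (σ⁻¹ i j)).congr (ae_of_all _ fun w => ?_)
    simp [hf, Matrix.mulVec, dotProduct, Finset.sum_mul, mul_assoc]
  have hsplit (w : Fin d → ℝ) : ((((σ⁻¹).transpose).mulVec w) j / τ) *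
      ((1:ℝ)/2 * (h (x + τ • μv + σ.mulVec w) - h (x + τ • μv - σ.mulVec w)))
        = (2 * τ)⁻¹ * (f w + f (-w)) := by
    simp only [hf, Matrix.mulVec_neg, Pi.neg_apply, ← sub_eq_add_neg]
    field_simp
    ring
  have hBEL := integral_malliavin_weight_mul hv hσ hC1 hC hC' (x + τ • μv) j
  rw [← hP, Real.coe_toNNReal _ hτ.le] at hBEL
  simp_rw [hsplit]
  rw [integral_const_mul, integral_add hfi hfi.comp_neg, integral_neg_eq_self, hBEL]
  simp_rw [add_assoc]
  rw [fderiv_integral_comp_add P hC1 hC hC' (Y := fun w => τ • μv + σ.mulVec w)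
    (hσm.measurable.const_add _)]
  field_simp
  ring
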